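/- Let a ≥ 0, b ≥ 1 and let E ⊆ ⋃_{n≥1} B_n^{a,b} be a stable set. The following are equivalent: (i) for every 1 < q < ∞, lim_n n^{−1/q}·β_{q,n}(E) = 0; (ii) for some 1 < q < ∞, lim_n n^{−1/q}·β_{q,n}(E) = 0; (iii) lim_n υ_n(E) = 0; (iv) for every ϱ > 0 there exists N ∈ ℕ such that for all n ≥ N, E ∩ B_n^{a,b} contains no ϱ-c₀⁺-sequence. -/

import Mathlib

open scoped BigOperators ENNReal

noncomputable section

namespace AsymSeminorms

variable {𝕜 : Type*} [RCLike 𝕜]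

/-- A pair of seminorms on `𝕜^n`, used to encode a (finite) basic sequence together with
the seminorm induced by an operator. -/
abbrev SNPair (𝕜 : Type*) [RCLike 𝕜] (n : ℕ) : Type _ :=
  Seminorm 𝕜 (Fin n → 𝕜) × Seminorm 𝕜 (Fin n → 𝕜)

/-- Truncation of a vector in `𝕜^n` to its first `m` coordinates (the rest set to `0`);
this encodes `∑_{i=1}^m a_i e_i`. -/
def trunc {n : ℕ} (m : ℕ) (a : Fin n → 𝕜) : Fin n → 𝕜 :=
  fun i => if (i : ℕ) < m then a i else 0

/-- Membership in the set `B_n^{a,b}` (here the constants are called `ca`, `cb`):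
`r = P.1` is a norm with `r(e_i) = 1`, both seminorms satisfy the `b`-basis inequality for
truncations, and `ρ = P.2` satisfies `ρ ≤ a·r`. -/
structure MemB (ca cb : ℝ) {n : ℕ} (P : SNPair 𝕜 n) : Prop where
  eq_zero_of : ∀ x : Fin n → 𝕜, P.1 x = 0 → x = 0
  single_eq_one : ∀ i : Fin n, P.1 (Pi.single i 1) = 1
  trunc_fst : ∀ m : ℕ, m ≤ n → ∀ a : Fin n → 𝕜, P.1 (trunc m a) ≤ cb * P.1 a
  trunc_snd : ∀ m : ℕ, m ≤ n → ∀ a : Fin n → 𝕜, P.2 (trunc m a) ≤ cb * P.2 a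
  snd_le : ∀ x : Fin n → 𝕜, P.2 x ≤ ca * P.1 x

/-- The metric `d_n` on `B_n^{a,b}`: the supremum, over coefficient vectors in the unit ball
of `ℓ_∞^n`, of the maximal deviation of the two seminorms. -/
def dB {n : ℕ} (P Q : SNPair 𝕜 n) : ℝ :=
  sSup {x : ℝ | ∃ a : Fin n → 𝕜, (∀ i, ‖a i‖ ≤ 1) ∧
      x = max |P.1 a - Q.1 a| |P.2 a - Q.2 a|}

/-- A family `E`, with `E n` a set of pairs of seminorms on `𝕜^n`; this encodes a subset of
`⋃_{n≥1} B_n^{a,b}`. -/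
abbrev Fam (𝕜 : Type*) [RCLike 𝕜] : Type _ := ∀ n : ℕ, Set (SNPair 𝕜 n)

/-- `E ⊆ ⋃_n B_n^{a,b}`. -/
def SubB (ca cb : ℝ) (E : Fam 𝕜) : Prop := ∀ n, ∀ P ∈ E n, MemB ca cb P

/-- `E` is closed: each `E ∩ B_n^{a,b}` is closed in `B_n^{a,b}` for the metric `d_n`. -/
def ClosedFam (ca cb : ℝ) (E : Fam 𝕜) : Prop :=
  ∀ n, ∀ P : SNPair 𝕜 n, MemB ca cb P →
    (∀ ε : ℝ, 0 < ε → ∃ Q ∈ E n, dB P Q < ε) → P ∈ E n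

/-- The `j`-th block piece: the vector `∑_{k_j < i ≤ k_{j+1}} a_i e_i` (with `0`-based
indexing of the cut points `k`). -/
def piece {n m : ℕ} (a : Fin n → 𝕜) (k : Fin (m + 1) → ℕ) (j : Fin m) : Fin n → 𝕜 :=
  fun i => if k j.castSucc ≤ (i : ℕ) ∧ (i : ℕ) < k j.succ then a i else 0

/-- `(s,σ) = Q` is a block of `(r,ρ) = P`. -/
def IsBlockOf {n m : ℕ} (P : SNPair 𝕜 n) (Q : SNPair 𝕜 m) : Prop :=
  ∃ (a : Fin n → 𝕜) (k : Fin (m + 1) → ℕ),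
    k 0 = 0 ∧ StrictMono k ∧ k (Fin.last m) ≤ n ∧
    (∀ j : Fin m, P.1 (piece a k j) = 1) ∧
    (∀ b : Fin m → 𝕜, Q.1 b = P.1 (∑ j : Fin m, b j • piece a k j)) ∧
    (∀ b : Fin m → 𝕜, Q.2 b = P.2 (∑ j : Fin m, b j • piece a k j))

/-- `E` contains all blocks of its members (that lie in the corresponding `B_m^{a,b}`). -/
def BlockClosedFam (ca cb : ℝ) (E : Fam 𝕜) : Prop :=
  ∀ n m : ℕ, ∀ P ∈ E n, ∀ Q : SNPair 𝕜 m, MemB ca cb Q → IsBlockOf P Q → Q ∈ E m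

/-- `E ⊆ ⋃_n B_n^{a,b}` is stable: closed and block closed. -/
def StableFam (ca cb : ℝ) (E : Fam 𝕜) : Prop :=
  SubB ca cb E ∧ ClosedFam ca cb E ∧ BlockClosedFam ca cb E

/-- `E` is an identity block: stable and `r = ρ` for each member. -/
def IdentityBlockFam (ca cb : ℝ) (E : Fam 𝕜) : Prop :=
  StableFam ca cb E ∧ ∀ n, ∀ P ∈ E n, P.1 = P.2

/-- The `ℓ_p^n` norm of a coefficient vector, `1 ≤ p ≤ ∞`. -/
def lpnorm (p : ℝ≥0∞) {n : ℕ} (a : Fin n → 𝕜) : ℝ :=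
  if p = ∞ then ⨆ i, ‖a i‖ else (∑ i, ‖a i‖ ^ p.toReal) ^ (1 / p.toReal)

/-- The sign `±1 ∈ 𝕜` associated to a Boolean. -/
def sgn (b : Bool) : 𝕜 := if b then 1 else -1

/-- The `L_p` norm of a real function of `n` independent Rademacher variables, i.e. of a
function on `{±1}^n` with the uniform probability measure. -/
def radLp (p : ℝ≥0∞) {n : ℕ} (F : (Fin n → Bool) → ℝ) : ℝ :=
  if p = ∞ then ⨆ ε : Fin n → Bool, |F ε|
  else ((∑ ε : Fin n → Bool, |F ε| ^ p.toReal) / 2 ^ n) ^ (1 / p.toReal)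

/-- `α_{p,n}(E)`: the infimum of the constants `T > 0` such that
`ρ(∑ a_i e_i) ≤ T ‖(a_i)‖_{ℓ_p^n}` for all `(r,ρ) ∈ E ∩ B_n^{a,b}`. -/
def alphaC (p : ℝ≥0∞) (E : Fam 𝕜) (n : ℕ) : ℝ :=
  sInf {T : ℝ | 0 < T ∧ ∀ P ∈ E n, ∀ a : Fin n → 𝕜, P.2 a ≤ T * lpnorm p a}

/-- `β_{q,n}(E)`: the infimum of the constants `C > 0` such that
`C r(∑ a_i e_i) ≥ ‖(a_i ρ(e_i))‖_{ℓ_q^n}` for all `(r,ρ) ∈ E ∩ B_n^{a,b}`. -/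
def betaC (q : ℝ≥0∞) (E : Fam 𝕜) (n : ℕ) : ℝ :=
  sInf {C : ℝ | 0 < C ∧ ∀ P ∈ E n, ∀ a : Fin n → 𝕜,
    lpnorm q (fun i => a i * ((P.2 (Pi.single i 1) : ℝ) : 𝕜)) ≤ C * P.1 a}

/-- `τ_{p,n}(E)`: the infimum of the constants `T > 0` such that
`‖ρ(∑ ε_i a_i e_i)‖_{L_p} ≤ T ‖(a_i)‖_{ℓ_p^n}` for all `(r,ρ) ∈ E ∩ B_n^{a,b}`. -/
def tauC (p : ℝ≥0∞) (E : Fam 𝕜) (n : ℕ) : ℝ :=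
  sInf {T : ℝ | 0 < T ∧ ∀ P ∈ E n, ∀ a : Fin n → 𝕜,
    radLp p (fun ε => P.2 (fun i => sgn (ε i) * a i)) ≤ T * lpnorm p a}

/-- `γ_{q,n}(E)`: the infimum of the constants `C > 0` such that
`C ‖r(∑ ε_i a_i e_i)‖_{L_q} ≥ ‖(a_i ρ(e_i))‖_{ℓ_q^n}` for all `(r,ρ) ∈ E ∩ B_n^{a,b}`. -/
def gammaC (q : ℝ≥0∞) (E : Fam 𝕜) (n : ℕ) : ℝ :=
  sInf {C : ℝ | 0 < C ∧ ∀ P ∈ E n, ∀ a : Fin n → 𝕜,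
    lpnorm q (fun i => a i * ((P.2 (Pi.single i 1) : ℝ) : 𝕜)) ≤
      C * radLp q (fun ε => P.1 (fun i => sgn (ε i) * a i))}

/-- `θ_n(E)`: the infimum of the constants `T > 0` such that
`ρ((1/n) ∑ a_i e_i) ≤ T ‖(a_i)‖_{ℓ_∞^n}` for all `(r,ρ) ∈ E ∩ B_n^{a,b}`. -/
def thetaC (E : Fam 𝕜) (n : ℕ) : ℝ :=
  sInf {T : ℝ | 0 < T ∧ ∀ P ∈ E n, ∀ a : Fin n → 𝕜,
    P.2 ((n : 𝕜)⁻¹ • a) ≤ T * lpnorm ∞ a}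

/-- `Θ_n(E)`: the infimum of the constants `T > 0` such that
`‖ρ((1/n) ∑ ε_i a_i e_i)‖_{L_1} ≤ T ‖(a_i)‖_{ℓ_∞^n}` for all `(r,ρ) ∈ E ∩ B_n^{a,b}`. -/
def bigThetaC (E : Fam 𝕜) (n : ℕ) : ℝ :=
  sInf {T : ℝ | 0 < T ∧ ∀ P ∈ E n, ∀ a : Fin n → 𝕜,
    radLp 1 (fun ε => P.2 ((n : 𝕜)⁻¹ • fun i => sgn (ε i) * a i)) ≤ T * lpnorm ∞ a}

/-- `υ_n(E)`: the infimum of the constants `C > 0` such that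
`C r(∑ a_i e_i) ≥ min_i |a_i| ρ(e_i)` for all `(r,ρ) ∈ E ∩ B_n^{a,b}`. -/
def upsC (E : Fam 𝕜) (n : ℕ) : ℝ :=
  sInf {C : ℝ | 0 < C ∧ ∀ P ∈ E n, ∀ a : Fin n → 𝕜,
    (⨅ i, ‖a i‖ * P.2 (Pi.single i 1)) ≤ C * P.1 a}

/-- `Υ_n(E)`: the infimum of the constants `C > 0` such that
`C ‖r(∑ ε_i a_i e_i)‖_{L_1} ≥ min_i |a_i| ρ(e_i)` for all `(r,ρ) ∈ E ∩ B_n^{a,b}`. -/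
def bigUpsC (E : Fam 𝕜) (n : ℕ) : ℝ :=
  sInf {C : ℝ | 0 < C ∧ ∀ P ∈ E n, ∀ a : Fin n → 𝕜,
    (⨅ i, ‖a i‖ * P.2 (Pi.single i 1)) ≤
      C * radLp 1 (fun ε => P.1 (fun i => sgn (ε i) * a i))}

end AsymSeminorms

namespace AsymSeminorms

/-- A `ϱ`-`c₀⁺`-sequence: `ρ(e_i) ≥ ϱ` for all `i`, and there exist scalars
`(a_i) ⊆ [ϱ,∞)` with `max_{1 ≤ m ≤ n} r(∑_{i=1}^m a_i e_i) ≤ 1`. -/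
def IsC0PlusSeq {𝕜 : Type*} [RCLike 𝕜] (ϱ : ℝ) {n : ℕ} (P : SNPair 𝕜 n) : Prop :=
  (∀ i : Fin n, ϱ ≤ P.2 (Pi.single i 1)) ∧
  ∃ a : Fin n → ℝ, (∀ i, ϱ ≤ a i) ∧
    ∀ m : ℕ, m ≤ n → P.1 (trunc m (fun i => ((a i : ℝ) : 𝕜))) ≤ 1

section Blocks

variable {𝕜 : Type*} [RCLike 𝕜]

theorem piece_eq_trunc_sub_trunc {n m : ℕ} (a : Fin n → 𝕜) {k : Fin (m + 1) → ℕ}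
    (hk : StrictMono k) (j : Fin m) :
    piece a k j = trunc (k j.succ) a - trunc (k j.castSucc) a := by
  have h : k j.castSucc < k j.succ := hk Fin.castSucc_lt_succ
  ext i
  simp only [piece, trunc, Pi.sub_apply]
  split_ifs <;> first | omega | simp

theorem single_eq_trunc_sub_trunc {n : ℕ} (a : Fin n → 𝕜) (i : Fin n) :
    a i • (Pi.single i 1 : Fin n → 𝕜) = trunc (i + 1) a - trunc i a := by
  ext l
  rcases lt_trichotomy (l : ℕ) i with h | h | h
  · have hl : l ≠ i := fun e => by simp [e] at h
    simp [trunc, hl, h, Nat.lt_succ_of_lt h]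
  · obtain rfl : l = i := Fin.ext h
    simp [trunc]
  · have hl : l ≠ i := fun e => by simp [e] at h
    have h1 : ¬ (l : ℕ) < i + 1 := by omega
    have h2 : ¬ (l : ℕ) < i := by omega
    simp only [trunc, Pi.sub_apply, if_neg h1, if_neg h2]
    simp [hl]

theorem sum_succ_sub_castSucc {M : Type*} [AddCommGroup M] :
    ∀ {m : ℕ} (g : Fin (m + 1) → M),
      ∑ j : Fin m, (g j.succ - g j.castSucc) = g (Fin.last m) - g 0
  | 0, g => by simp
  | m + 1, g => by
    have h := sum_succ_sub_castSucc (fun j : Fin (m + 1) => g j.castSucc)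
    simp only [Fin.castSucc_zero] at h
    rw [Fin.sum_univ_castSucc]
    simp only [Fin.succ_castSucc, h, Fin.succ_last]
    abel

theorem sum_piece {n m : ℕ} (a : Fin n → 𝕜) {k : Fin (m + 1) → ℕ}
    (hk : StrictMono k) (hk0 : k 0 = 0) :
    ∑ j : Fin m, piece a k j = trunc (k (Fin.last m)) a := by
  simp only [piece_eq_trunc_sub_trunc a hk]
  rw [sum_succ_sub_castSucc (fun j => trunc (k j) a), hk0]
  ext i
  simp [trunc]

theorem trunc_trunc {n : ℕ} {l m : ℕ} (h : l ≤ m) (a : Fin n → 𝕜) :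
    trunc l (trunc m a) = trunc l a := by
  ext i
  simp only [trunc]
  split_ifs <;> first | rfl | omega

/-- The linear map sending the basis vectors to the block pieces of `a`. -/
def blockMap {n m : ℕ} (a : Fin n → 𝕜) (k : Fin (m + 1) → ℕ) :
    (Fin m → 𝕜) →ₗ[𝕜] (Fin n → 𝕜) :=
  Fintype.linearCombination 𝕜 (piece a k)

theorem blockMap_apply {n m : ℕ} (a : Fin n → 𝕜) (k : Fin (m + 1) → ℕ) (c : Fin m → 𝕜) :
    blockMap a k c = ∑ j : Fin m, c j • piece a k j := rfl

theorem trunc_blockMap {n m : ℕ} (a : Fin n → 𝕜) {k : Fin (m + 1) → ℕ}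
    (hk : StrictMono k) (c : Fin m → 𝕜) (l : Fin (m + 1)) :
    trunc (k l) (blockMap a k c) = blockMap a k (trunc l c) := by
  ext i
  simp only [blockMap_apply, trunc, Finset.sum_apply, Pi.smul_apply, piece, smul_eq_mul]
  have key : ∀ j : Fin m, (if (j : ℕ) < l then c j else 0) *
      (if k j.castSucc ≤ (i : ℕ) ∧ (i : ℕ) < k j.succ then a i else 0) =
      if (i : ℕ) < k l then
        c j * (if k j.castSucc ≤ (i : ℕ) ∧ (i : ℕ) < k j.succ then a i else 0) else 0 := by
    intro j
    by_cases hi : k j.castSucc ≤ (i : ℕ) ∧ (i : ℕ) < k j.succ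
    · have hiff : (i : ℕ) < k l ↔ (j : ℕ) < l := by
        constructor
        · intro h
          exact hk.lt_iff_lt.1 (hi.1.trans_lt h)
        · intro h
          exact hi.2.trans_le (hk.monotone (show j.succ ≤ l from h))
      simp [hi, hiff]
    · simp [hi]
  simp only [key]
  split_ifs <;> simp

theorem piece_blockMap {n m : ℕ} (a : Fin n → 𝕜) {k : Fin (m + 1) → ℕ}
    (hk : StrictMono k) (c : Fin m → 𝕜) (j : Fin m) :
    piece (blockMap a k c) k j = c j • piece a k j := by
  rw [piece_eq_trunc_sub_trunc _ hk, trunc_blockMap a hk, trunc_blockMap a hk, ← map_sub,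
    show trunc (j.succ : Fin (m + 1)) c - trunc (j.castSucc : Fin (m + 1)) c
      = c j • (Pi.single j 1 : Fin m → 𝕜) from
      (single_eq_trunc_sub_trunc c j).symm, map_smul, blockMap,
    Fintype.linearCombination_apply_single, one_smul]

end Blocks

section Estimates

variable {𝕜 : Type*} [RCLike 𝕜] {n : ℕ} {cb : ℝ} {p : Seminorm 𝕜 (Fin n → 𝕜)}

theorem seminorm_piece_le (hp : ∀ m : ℕ, m ≤ n → ∀ a : Fin n → 𝕜, p (trunc m a) ≤ cb * p a)
    {m : ℕ} (a : Fin n → 𝕜) {k : Fin (m + 1) → ℕ} (hk : StrictMono k)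
    (hkn : k (Fin.last m) ≤ n) (j : Fin m) : p (piece a k j) ≤ 2 * cb * p a := by
  rw [piece_eq_trunc_sub_trunc a hk]
  have h1 := hp _ ((hk.monotone (Fin.le_last j.succ)).trans hkn) a
  have h2 := hp _ ((hk.monotone (Fin.le_last j.castSucc)).trans hkn) a
  linarith [map_sub_le_add p (trunc (k j.succ) a) (trunc (k j.castSucc) a)]

theorem norm_mul_seminorm_single_le
    (hp : ∀ m : ℕ, m ≤ n → ∀ a : Fin n → 𝕜, p (trunc m a) ≤ cb * p a)
    (a : Fin n → 𝕜) (i : Fin n) : ‖a i‖ * p (Pi.single i 1) ≤ 2 * cb * p a := by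
  rw [← map_smul_eq_mul, single_eq_trunc_sub_trunc]
  have h1 := hp (i + 1) i.2 a
  have h2 := hp i i.2.le a
  linarith [map_sub_le_add p (trunc (i + 1) a) (trunc i a)]

end Estimates

section Main

variable {𝕜 : Type*} [RCLike 𝕜]

theorem MemB.comp_blockMap {ca cb : ℝ} {n m : ℕ} {P : SNPair 𝕜 n} (hP : MemB ca cb P)
    (a : Fin n → 𝕜) {k : Fin (m + 1) → ℕ} (hk : StrictMono k) (hkn : k (Fin.last m) ≤ n)
    (ha : ∀ j, P.1 (piece a k j) = 1) :
    MemB ca cb ((P.1.comp (blockMap a k), P.2.comp (blockMap a k)) : SNPair 𝕜 m) where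
  eq_zero_of c hc := by
    have h0 : blockMap a k c = 0 := hP.eq_zero_of _ hc
    ext j
    have h1 := piece_blockMap a hk c j
    have h2 : piece (0 : Fin n → 𝕜) k j = 0 := by ext; simp [piece]
    rw [h0, h2] at h1
    rcases smul_eq_zero.1 h1.symm with h | h
    · exact h
    · have := ha j
      simp [h] at this
  single_eq_one j := by
    simp [blockMap, Fintype.linearCombination_apply_single, ha]
  trunc_fst l hl c := by
    have h := trunc_blockMap a hk c ⟨l, Nat.lt_succ_of_le hl⟩
    simp only [Seminorm.comp_apply]
    rw [← h]
    exact hP.trunc_fst _ ((hk.monotone (Fin.le_last _)).trans hkn) _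
  trunc_snd l hl c := by
    have h := trunc_blockMap a hk c ⟨l, Nat.lt_succ_of_le hl⟩
    simp only [Seminorm.comp_apply]
    rw [← h]
    exact hP.trunc_snd _ ((hk.monotone (Fin.le_last _)).trans hkn) _
  snd_le c := hP.snd_le _

/-- If `r(x) ≤ 1`, blocking `x` at the coordinates where `|x_i| ρ(e_i)` is at least `δ` yields a
`c₀⁺`-sequence. -/
theorem exists_isC0PlusSeq {ca cb : ℝ} (hca : 0 ≤ ca) (hcb : 1 ≤ cb) {E : Fam 𝕜}
    (hE : StableFam ca cb E) {δ : ℝ} (hδ : 0 < δ) {n : ℕ} {P : SNPair 𝕜 n} (hPE : P ∈ E n)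
    {x : Fin n → 𝕜} (hx : P.1 x ≤ 1) {A : Finset (Fin n)}
    (hA : ∀ i ∈ A, δ ≤ ‖x i‖ * P.2 (Pi.single i 1)) :
    ∃ Q ∈ E A.card, IsC0PlusSeq (δ / (4 * cb ^ 2 * (ca + 1))) Q := by
  have hP := hE.1 n P hPE
  have hcb0 : 0 < cb := by linarith
  set o := A.orderEmbOfFin rfl
  set k : Fin (A.card + 1) → ℕ := Fin.cons 0 (fun j => (o j : ℕ) + 1)
  have hk0 : k 0 = 0 := rfl
  have hks : ∀ j : Fin A.card, k j.succ = o j + 1 := fun j => rfl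
  have hk : StrictMono k := by
    refine Fin.strictMono_iff_lt_succ.2 fun j => ?_
    rw [hks]
    rcases Fin.eq_zero_or_eq_succ j.castSucc with h | ⟨l, hl⟩
    · rw [h, hk0]; omega
    · rw [hl, hks]
      have : l < j := by
        have := congrArg Fin.val hl
        simp only [Fin.val_castSucc, Fin.val_succ] at this
        exact Fin.lt_def.2 (by omega)
      have := Fin.lt_def.1 (o.strictMono this)
      omega
  have hkn : k (Fin.last A.card) ≤ n := by
    rcases Fin.eq_zero_or_eq_succ (Fin.last A.card) with h | ⟨l, hl⟩
    · rw [h, hk0]; omega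
    · rw [hl, hks]; exact (o l).2
  set t : Fin A.card → ℝ := fun j => P.1 (piece x k j)
  have hρ : ∀ j, δ / (2 * cb) ≤ P.2 (piece x k j) := by
    intro j
    have h1 := norm_mul_seminorm_single_le hP.trunc_snd (piece x k j) (o j)
    have h2 : piece x k j (o j) = x (o j) := by
      have : k j.castSucc < k j.succ := hk Fin.castSucc_lt_succ
      rw [hks] at this
      simp only [piece, hks]
      rw [if_pos (by omega)]
    rw [h2] at h1
    rw [div_le_iff₀ (by positivity)]
    linarith [hA _ (A.orderEmbOfFin_mem rfl j)]
  have htle : ∀ j, t j ≤ 2 * cb := fun j =>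
    (seminorm_piece_le hP.trunc_fst x hk hkn j).trans (by nlinarith)
  have htge : ∀ j, δ / (2 * cb * (ca + 1)) ≤ t j := by
    intro j
    have h1 := hP.snd_le (piece x k j)
    have h2 : 0 ≤ t j := apply_nonneg _ _
    rw [← div_div, div_le_iff₀ (by positivity)]
    have h3 : P.2 (piece x k j) ≤ ca * t j := h1
    nlinarith [hρ j]
  have htpos : ∀ j, 0 < t j := fun j => lt_of_lt_of_le (by positivity) (htge j)
  have htk : ∀ j, (t j : 𝕜) ≠ 0 := fun j => by exact_mod_cast (htpos j).ne'
  set y : Fin n → 𝕜 := blockMap x k (fun j => ((t j : ℝ) : 𝕜)⁻¹)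
  have hpy : ∀ j, piece y k j = ((t j : ℝ) : 𝕜)⁻¹ • piece x k j := fun j =>
    piece_blockMap x hk _ j
  have hnorm : ∀ j, ‖((t j : ℝ) : 𝕜)⁻¹‖ = (t j)⁻¹ := fun j => by
    rw [norm_inv, RCLike.norm_ofReal, abs_of_pos (htpos j)]
  have hy1 : ∀ j, P.1 (piece y k j) = 1 := fun j => by
    rw [hpy, map_smul_eq_mul, hnorm]
    exact inv_mul_cancel₀ (htpos j).ne'
  refine ⟨_, hE.2.2 n _ P hPE _ (hP.comp_blockMap y hk hkn hy1)
    ⟨y, k, hk0, hk, hkn, hy1, fun _ => rfl, fun _ => rfl⟩, fun j => ?_, fun j => t j / cb,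
    fun j => ?_, fun m hm => ?_⟩
  · have h1 : P.2 (piece y k j) = (t j)⁻¹ * P.2 (piece x k j) := by
      rw [hpy, map_smul_eq_mul, hnorm]
    simp only [Seminorm.comp_apply, blockMap, Fintype.linearCombination_apply_single, one_smul]
    rw [h1]
    have h2 : (2 * cb)⁻¹ ≤ (t j)⁻¹ := inv_anti₀ (htpos j) (htle j)
    calc δ / (4 * cb ^ 2 * (ca + 1)) ≤ δ / (4 * cb ^ 2) := by
          refine div_le_div_of_nonneg_left hδ.le (by positivity) ?_
          nlinarith [sq_nonneg cb]
      _ = (2 * cb)⁻¹ * (δ / (2 * cb)) := by field_simp; norm_num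
      _ ≤ _ := mul_le_mul h2 (hρ j) (by positivity) (inv_nonneg.2 (htpos j).le)
  · rw [le_div_iff₀ hcb0]
    refine le_trans (le_of_eq ?_) (le_trans (?_ : δ / (2 * cb * (ca + 1)) / 2 ≤ _) (htge j))
    · field_simp
      norm_num
    · exact half_le_self (by positivity)
  · set l : Fin (A.card + 1) := ⟨m, Nat.lt_succ_of_le hm⟩
    have h1 : blockMap y k (fun j => ((t j / cb : ℝ) : 𝕜))
        = ((cb⁻¹ : ℝ) : 𝕜) • trunc (k (Fin.last A.card)) x := by
      rw [blockMap_apply, ← sum_piece x hk hk0, Finset.smul_sum]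
      refine Finset.sum_congr rfl fun j _ => ?_
      rw [hpy, smul_smul]
      congr 1
      push_cast
      have := htk j
      field_simp
    have h2 : trunc (k l) (((cb⁻¹ : ℝ) : 𝕜) • trunc (k (Fin.last A.card)) x)
        = ((cb⁻¹ : ℝ) : 𝕜) • trunc (k l) x := by
      rw [← trunc_trunc (hk.monotone (Fin.le_last l)) x]
      ext i
      simp [trunc]
    have h3 := trunc_blockMap y hk (fun j => ((t j / cb : ℝ) : 𝕜)) l
    rw [h1, h2] at h3
    have h4 := hP.trunc_fst (k l) ((hk.monotone (Fin.le_last l)).trans hkn) x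
    change P.1 (blockMap y k (trunc (l : ℕ) _)) ≤ 1
    rw [← h3, map_smul_eq_mul, RCLike.norm_ofReal, abs_of_pos (by positivity),
      inv_mul_le_iff₀ hcb0]
    nlinarith

theorem lpnorm_ofReal {q : ℝ} (hq : 0 ≤ q) {n : ℕ} (a : Fin n → 𝕜) :
    lpnorm (ENNReal.ofReal q) a = (∑ i, ‖a i‖ ^ q) ^ (1 / q) := by
  simp [lpnorm, ENNReal.toReal_ofReal hq]

theorem lpnorm_mul_seminorm {q : ℝ} (hq : 0 ≤ q) {n : ℕ} (p : Seminorm 𝕜 (Fin n → 𝕜))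
    (a : Fin n → 𝕜) :
    lpnorm (ENNReal.ofReal q) (fun i => a i * ((p (Pi.single i 1) : ℝ) : 𝕜)) =
      (∑ i, (‖a i‖ * p (Pi.single i 1)) ^ q) ^ (1 / q) := by
  rw [lpnorm_ofReal hq]
  congr 1
  refine Finset.sum_congr rfl fun i _ => ?_
  rw [norm_mul, RCLike.norm_ofReal, abs_of_nonneg (apply_nonneg _ _)]

theorem betaC_nonneg (q : ℝ≥0∞) (E : Fam 𝕜) (n : ℕ) : 0 ≤ betaC q E n :=
  Real.sInf_nonneg fun _ h => h.1.le

theorem upsC_nonneg (E : Fam 𝕜) (n : ℕ) : 0 ≤ upsC E n :=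
  Real.sInf_nonneg fun _ h => h.1.le

theorem norm_mul_snd_single_le {ca cb : ℝ} (hca : 0 ≤ ca) {n : ℕ} {P : SNPair 𝕜 n}
    (hP : MemB ca cb P) (x : Fin n → 𝕜) (i : Fin n) :
    ‖x i‖ * P.2 (Pi.single i 1) ≤ 2 * cb * ca * P.1 x := by
  have h1 := norm_mul_seminorm_single_le hP.trunc_fst x i
  have h2 := hP.snd_le (Pi.single i 1)
  rw [hP.single_eq_one] at h1 h2
  nlinarith [norm_nonneg (x i), mul_le_mul_of_nonneg_left h2 (norm_nonneg (x i))]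

/-- If at most `N` of the `|x_i| ρ(e_i)` exceed `δ r(x)`, then the `ℓ_q` norm is controlled. -/
theorem lpnorm_le_of_card_le {ca cb : ℝ} (hca : 0 ≤ ca) (hcb : 1 ≤ cb) {q : ℝ} (hq : 1 < q)
    {δ : ℝ} (hδ : 0 < δ) {n N : ℕ} {P : SNPair 𝕜 n} (hP : MemB ca cb P) (x : Fin n → 𝕜)
    (hN : (Finset.univ.filter
      fun i => δ * P.1 x ≤ ‖x i‖ * P.2 (Pi.single i 1)).card ≤ N) :
    lpnorm (ENNReal.ofReal q) (fun i => x i * ((P.2 (Pi.single i 1) : ℝ) : 𝕜)) ≤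
      (N * (2 * cb * ca) ^ q + n * δ ^ q) ^ (1 / q) * P.1 x := by
  have hr : 0 ≤ P.1 x := apply_nonneg _ _
  have hM : 0 ≤ 2 * cb * ca := by positivity
  rw [lpnorm_mul_seminorm (by linarith)]
  have hnn : ∀ i, 0 ≤ ‖x i‖ * P.2 (Pi.single i 1) := fun i =>
    mul_nonneg (norm_nonneg _) (apply_nonneg _ _)
  have hsum : ∑ i, (‖x i‖ * P.2 (Pi.single i 1)) ^ q ≤
      (N * (2 * cb * ca) ^ q + n * δ ^ q) * P.1 x ^ q := by
    rw [← Finset.sum_filter_add_sum_filter_not Finset.univ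
      (fun i => δ * P.1 x ≤ ‖x i‖ * P.2 (Pi.single i 1)), add_mul]
    refine add_le_add ?_ ?_
    · refine (Finset.sum_le_card_nsmul _ _ ((2 * cb * ca) ^ q * P.1 x ^ q) fun i _ => ?_).trans ?_
      · rw [← Real.mul_rpow hM hr]
        exact Real.rpow_le_rpow (hnn i) (norm_mul_snd_single_le hca hP x i) (by linarith)
      · rw [nsmul_eq_mul, mul_assoc (N : ℝ)]
        gcongr
    · refine (Finset.sum_le_card_nsmul _ _ (δ ^ q * P.1 x ^ q) fun i hi => ?_).trans ?_
      · rw [← Real.mul_rpow hδ.le hr]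
        exact Real.rpow_le_rpow (hnn i) (not_le.1 (Finset.mem_filter.1 hi).2).le (by linarith)
      · rw [nsmul_eq_mul, mul_assoc]
        gcongr
        exact (Finset.card_le_univ _).trans_eq (Fintype.card_fin n)
  calc _ ≤ ((N * (2 * cb * ca) ^ q + n * δ ^ q) * P.1 x ^ q) ^ (1 / q) :=
        Real.rpow_le_rpow (Finset.sum_nonneg fun i _ => Real.rpow_nonneg (hnn i) _) hsum
          (by positivity)
    _ = _ := by
        rw [Real.mul_rpow (by positivity) (by positivity), ← Real.rpow_mul hr,
          mul_one_div_cancel (by linarith), Real.rpow_one]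

theorem betaC_le_of_card_le {ca cb : ℝ} (hca : 0 ≤ ca) (hcb : 1 ≤ cb) {q : ℝ} (hq : 1 < q)
    {E : Fam 𝕜} (hE : SubB ca cb E) {δ : ℝ} (hδ : 0 < δ) {n N : ℕ} (hn : 0 < n)
    (hN : ∀ P ∈ E n, ∀ x : Fin n → 𝕜, P.1 x ≠ 0 → (Finset.univ.filter
      fun i => δ * P.1 x ≤ ‖x i‖ * P.2 (Pi.single i 1)).card ≤ N) :
    betaC (ENNReal.ofReal q) E n ≤ (N * (2 * cb * ca) ^ q + n * δ ^ q) ^ (1 / q) := by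
  refine csInf_le ⟨0, fun _ h => h.1.le⟩ ⟨by positivity, fun P hP x => ?_⟩
  by_cases hx : P.1 x = 0
  · have := (hE n P hP).eq_zero_of x hx
    subst this
    rw [lpnorm_mul_seminorm (by linarith), hx]
    have h0 : q ≠ 0 := by linarith
    simp [Real.zero_rpow, h0]
  · exact lpnorm_le_of_card_le hca hcb hq hδ (hE n P hP) x (hN P hP x hx)

theorem upsC_le_rpow_mul_betaC {ca cb : ℝ} (hca : 0 ≤ ca) (hcb : 1 ≤ cb) {q : ℝ} (hq : 1 < q)
    {E : Fam 𝕜} (hE : SubB ca cb E) {n : ℕ} (hn : 0 < n) :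
    upsC E n ≤ (n : ℝ) ^ (-(1 / q)) * betaC (ENNReal.ofReal q) E n := by
  have hn' : (0 : ℝ) < n := by exact_mod_cast hn
  have hpos : 0 < (n : ℝ) ^ (1 / q) := by positivity
  rw [Real.rpow_neg hn'.le, le_inv_mul_iff₀ hpos]
  refine le_csInf ⟨((n : ℝ) * (2 * cb * ca) ^ q + n * 1 ^ q) ^ (1 / q), by positivity,
    fun P hP x => lpnorm_le_of_card_le hca hcb hq one_pos (hE n P hP) x
      ((Finset.card_le_univ _).trans_eq (Fintype.card_fin n))⟩ ?_
  rintro C ⟨hC, hCE⟩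
  rw [← le_inv_mul_iff₀ hpos]
  refine csInf_le ⟨0, fun _ h => h.1.le⟩ ⟨by positivity, fun P hP x => ?_⟩
  rw [mul_assoc, le_inv_mul_iff₀ hpos]
  refine le_trans ?_ (hCE P hP x)
  rw [lpnorm_mul_seminorm (by linarith)]
  set v : Fin n → ℝ := fun i => ‖x i‖ * P.2 (Pi.single i 1)
  have hv0 : ∀ i, 0 ≤ v i := fun i => mul_nonneg (norm_nonneg _) (apply_nonneg _ _)
  have hm : 0 ≤ ⨅ i, v i := Real.iInf_nonneg hv0
  calc (n : ℝ) ^ (1 / q) * ⨅ i, v i = (∑ _i : Fin n, (⨅ i, v i) ^ q) ^ (1 / q) := by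
        rw [Finset.sum_const, Finset.card_univ, Fintype.card_fin, nsmul_eq_mul,
          Real.mul_rpow hn'.le (by positivity), ← Real.rpow_mul hm,
          mul_one_div_cancel (by linarith), Real.rpow_one]
    _ ≤ (∑ i, v i ^ q) ^ (1 / q) := by
        gcongr with i _
        exact ciInf_le ⟨0, by rintro _ ⟨j, rfl⟩; exact hv0 j⟩ i

theorem IsC0PlusSeq.sq_le_upsC {ca cb : ℝ} (hca : 0 ≤ ca) (hcb : 1 ≤ cb) {E : Fam 𝕜}
    (hE : SubB ca cb E) {n : ℕ} (hn : 0 < n) {ϱ : ℝ} (hϱ : 0 < ϱ) {P : SNPair 𝕜 n}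
    (hPE : P ∈ E n) (hP : IsC0PlusSeq ϱ P) : ϱ ^ 2 ≤ upsC E n := by
  have : Nonempty (Fin n) := ⟨⟨0, hn⟩⟩
  obtain ⟨hρ, a, ha, hsum⟩ := hP
  refine le_csInf ⟨2 * cb * ca + 1, by positivity, fun R hR x => ?_⟩ ?_
  · have h1 := norm_mul_snd_single_le hca (hE n R hR) x ⟨0, hn⟩
    refine (ciInf_le ⟨0, ?_⟩ (⟨0, hn⟩ : Fin n)).trans ?_
    · rintro _ ⟨j, rfl⟩
      exact mul_nonneg (norm_nonneg _) (apply_nonneg _ _)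
    · linarith [apply_nonneg R.1 x]
  · rintro C ⟨hC, hCE⟩
    have h1 := hCE P hPE (fun i => ((a i : ℝ) : 𝕜))
    have h2 := hsum n le_rfl
    have h3 : trunc n (fun i => ((a i : ℝ) : 𝕜)) = fun i => ((a i : ℝ) : 𝕜) := by
      ext i
      simp [trunc]
    rw [h3] at h2
    have h4 : ϱ ^ 2 ≤ ⨅ i, ‖((a i : ℝ) : 𝕜)‖ * P.2 (Pi.single i 1) := by
      refine le_ciInf fun i => ?_
      rw [RCLike.norm_ofReal, sq]
      exact mul_le_mul ((ha i).trans (le_abs_self _)) (hρ i) hϱ.le (abs_nonneg _)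
    nlinarith

/-- Absence of long `c₀⁺`-sequences bounds the number of large coordinates. -/
theorem exists_card_le_of_forall_not_isC0PlusSeq {ca cb : ℝ} (hca : 0 ≤ ca) (hcb : 1 ≤ cb)
    {E : Fam 𝕜} (hE : StableFam ca cb E)
    (h : ∀ ϱ : ℝ, 0 < ϱ → ∃ N : ℕ, ∀ n : ℕ, N ≤ n → ∀ P ∈ E n, ¬ IsC0PlusSeq ϱ P)
    {δ : ℝ} (hδ : 0 < δ) :
    ∃ N : ℕ, ∀ n, ∀ P ∈ E n, ∀ x : Fin n → 𝕜, P.1 x ≠ 0 → (Finset.univ.filter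
      fun i => δ * P.1 x ≤ ‖x i‖ * P.2 (Pi.single i 1)).card ≤ N := by
  have hcb0 : 0 < cb := by linarith
  obtain ⟨N, hN⟩ := h (δ / (4 * cb ^ 2 * (ca + 1))) (by positivity)
  refine ⟨N, fun n P hP x hx => ?_⟩
  have hr : 0 < P.1 x := lt_of_le_of_ne (apply_nonneg _ _) (Ne.symm hx)
  have hinv : ‖(((P.1 x)⁻¹ : ℝ) : 𝕜)‖ = (P.1 x)⁻¹ := by
    rw [RCLike.norm_ofReal, abs_of_pos (by positivity)]
  by_contra! hlt
  obtain ⟨Q, hQ, hQ0⟩ := exists_isC0PlusSeq hca hcb hE hδ hP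
    (x := (((P.1 x)⁻¹ : ℝ) : 𝕜) • x)
    (A := Finset.univ.filter fun i => δ * P.1 x ≤ ‖x i‖ * P.2 (Pi.single i 1))
    (by rw [map_smul_eq_mul, hinv, inv_mul_cancel₀ hx])
    (fun i hi => by
      rw [Pi.smul_apply, norm_smul, hinv, mul_assoc, le_inv_mul_iff₀ hr, mul_comm]
      exact (Finset.mem_filter.1 hi).2)
  exact hN _ hlt.le Q hQ hQ0

theorem tendsto_betaC_of_forall_not_isC0PlusSeq {ca cb : ℝ} (hca : 0 ≤ ca) (hcb : 1 ≤ cb)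
    {E : Fam 𝕜} (hE : StableFam ca cb E)
    (h : ∀ ϱ : ℝ, 0 < ϱ → ∃ N : ℕ, ∀ n : ℕ, N ≤ n → ∀ P ∈ E n, ¬ IsC0PlusSeq ϱ P)
    {q : ℝ} (hq : 1 < q) :
    Filter.Tendsto (fun n : ℕ => (n : ℝ) ^ (-(1 / q)) * betaC (ENNReal.ofReal q) E n)
      Filter.atTop (nhds 0) := by
  have hq0 : 0 < q := by linarith
  have hnn : ∀ n : ℕ, 0 ≤ (n : ℝ) ^ (-(1 / q)) * betaC (ENNReal.ofReal q) E n := fun n =>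
    mul_nonneg (Real.rpow_nonneg n.cast_nonneg _) (betaC_nonneg _ _ _)
  refine tendsto_order.2 ⟨fun c hc => Filter.Eventually.of_forall fun n => hc.trans_le (hnn n),
    fun ε hε => ?_⟩
  obtain ⟨N, hN⟩ :=
    exists_card_le_of_forall_not_isC0PlusSeq hca hcb hE h (half_pos hε)
  have hlim : Filter.Tendsto (fun n : ℕ => N * (2 * cb * ca) ^ q / (n : ℝ) + (ε / 2) ^ q)
      Filter.atTop (nhds (0 + (ε / 2) ^ q)) :=
    (tendsto_const_div_atTop_nhds_zero_nat _).add_const _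
  have hlt : 0 + (ε / 2) ^ q < ε ^ q := by
    rw [zero_add]
    exact Real.rpow_lt_rpow (by positivity) (half_lt_self hε) hq0
  filter_upwards [hlim.eventually_lt_const hlt, Filter.eventually_gt_atTop 0] with n hn hn0
  have hn' : (0 : ℝ) < n := by exact_mod_cast hn0
  have hβ := betaC_le_of_card_le hca hcb hq hE.1 (half_pos hε) hn0 (hN n)
  rw [Real.rpow_neg hn'.le, inv_mul_lt_iff₀ (by positivity)]
  refine hβ.trans_lt ?_
  calc _ < (n * ε ^ q) ^ (1 / q) := by
        refine Real.rpow_lt_rpow (by positivity) ?_ (by positivity)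
        have := mul_lt_mul_of_pos_left hn hn'
        rwa [mul_add, mul_div_cancel₀ _ hn'.ne'] at this
    _ = _ := by
        rw [Real.mul_rpow hn'.le (by positivity), ← Real.rpow_mul hε.le,
          mul_one_div_cancel hq0.ne', Real.rpow_one]

end Main

/-- Theorem 3.4, block basic subcotype: for a stable set
`E ⊆ ⋃_{n≥1} B_n^{a,b}` the following are equivalent: block basic subcotype `q` for all
`1 < q < ∞`; block basic subcotype `q` for some `1 < q < ∞`; block basic subcotype
(`υ_n(E) → 0`); and, for every `ϱ > 0`, the absence of `ϱ`-`c₀⁺`-sequences in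
`E ∩ B_n^{a,b}` for all large `n`. -/
theorem block_basic_subcotype_tfae {𝕜 : Type*} [RCLike 𝕜]
    (ca cb : ℝ) (hca : 0 ≤ ca) (hcb : 1 ≤ cb)
    (E : Fam 𝕜) (hE : StableFam ca cb E) :
    List.TFAE
      [∀ q : ℝ, 1 < q →
          Filter.Tendsto
            (fun n : ℕ => (n : ℝ) ^ (-(1 / q)) * betaC (ENNReal.ofReal q) E n)
            Filter.atTop (nhds 0),
        ∃ q : ℝ, 1 < q ∧
          Filter.Tendsto
            (fun n : ℕ => (n : ℝ) ^ (-(1 / q)) * betaC (ENNReal.ofReal q) E n)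
            Filter.atTop (nhds 0),
        Filter.Tendsto (fun n : ℕ => upsC E n) Filter.atTop (nhds 0),
        ∀ ϱ : ℝ, 0 < ϱ → ∃ N : ℕ, ∀ n : ℕ, N ≤ n → ∀ P ∈ E n, ¬ IsC0PlusSeq ϱ P] := by
  tfae_have 1 → 2 := fun h => ⟨2, one_lt_two, h 2 one_lt_two⟩
  tfae_have 2 → 3 := by
    rintro ⟨q, hq, h⟩
    refine squeeze_zero' (Filter.Eventually.of_forall (upsC_nonneg E)) ?_ h
    filter_upwards [Filter.eventually_gt_atTop 0] with n hn
    exact upsC_le_rpow_mul_betaC hca hcb hq hE.1 hn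
  tfae_have 3 → 4 := by
    intro h ϱ hϱ
    obtain ⟨N, hN⟩ := Filter.eventually_atTop.1 (h.eventually_lt_const (pow_pos hϱ 2))
    refine ⟨N + 1, fun n hn P hP hc => ?_⟩
    exact (hN n (by omega)).not_ge (hc.sq_le_upsC hca hcb hE.1 (by omega) hϱ hP)
  tfae_have 4 → 1 := fun h q hq => tendsto_betaC_of_forall_not_isC0PlusSeq hca hcb hE h hq
  tfae_finish

end AsymSeminorms
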